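/- Let B be a symmetric n×n real matrix, P a symmetric n×n real matrix with P² = P, g ∈ ℝⁿ, p = Pg, and τ > 0 such that τI + B is positive definite and τI + B − PᵀBP is positive definite. Let d solve (τI + B)d = −p, let q(x) = f₀ + (x − x₀)ᵀg + ½(x − x₀)ᵀB(x − x₀), and set τ_lb = min{0, μ_min(B − PᵀBP)}, where μ_min denotes the smallest eigenvalue of a symmetric matrix. Then q(x₀) − q(x₀ + Pd) ≥ ½( ‖p‖²/(τ + ‖B‖) + (τ + τ_lb)‖d‖² ). -/

import Mathlib

open Matrix

noncomputable def vecNorm {n : ℕ} (x : Fin n → ℝ) : ℝ :=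
  ‖(WithLp.equiv 2 (Fin n → ℝ)).symm x‖

noncomputable def matNorm {n : ℕ} (M : Matrix (Fin n) (Fin n) ℝ) : ℝ :=
  ‖Matrix.toEuclideanCLM (𝕜 := ℝ) M‖

theorem vecNorm_sq {n : ℕ} (x : Fin n → ℝ) : vecNorm x ^ 2 = x ⬝ᵥ x := by
  simp [vecNorm, EuclideanSpace.real_norm_sq_eq, dotProduct, ← sq]

theorem dotProduct_mulVec_le_matNorm {n : ℕ} (M : Matrix (Fin n) (Fin n) ℝ) (x : Fin n → ℝ) :
    x ⬝ᵥ (M *ᵥ x) ≤ matNorm M * vecNorm x ^ 2 := by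
  set y : EuclideanSpace ℝ (Fin n) := WithLp.toLp 2 x
  have hinner : x ⬝ᵥ (M *ᵥ x) = inner ℝ y (Matrix.toEuclideanCLM (𝕜 := ℝ) M y) :=
    (Matrix.inner_toEuclideanCLM M y y).symm
  calc x ⬝ᵥ (M *ᵥ x) ≤ ‖y‖ * ‖Matrix.toEuclideanCLM (𝕜 := ℝ) M y‖ :=
        hinner ▸ real_inner_le_norm _ _
    _ ≤ ‖y‖ * (‖Matrix.toEuclideanCLM (𝕜 := ℝ) M‖ * ‖y‖) := by
        gcongr
        exact ContinuousLinearMap.le_opNorm _ _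
    _ = matNorm M * vecNorm x ^ 2 := by
        change ‖y‖ * (matNorm M * ‖y‖) = matNorm M * ‖y‖ ^ 2
        ring

open scoped MatrixOrder in
/-- Rayleigh-quotient lower bound by the smallest eigenvalue. -/
theorem iInf_eigenvalues_mul_le {n : ℕ} {M : Matrix (Fin n) (Fin n) ℝ} (hM : M.IsHermitian)
    (x : Fin n → ℝ) : (⨅ i, hM.eigenvalues i) * (x ⬝ᵥ x) ≤ x ⬝ᵥ (M *ᵥ x) := by
  have hle : algebraMap ℝ (Matrix (Fin n) (Fin n) ℝ) (⨅ i, hM.eigenvalues i) ≤ M := by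
    rw [algebraMap_le_iff_le_spectrum (ha := hM.isSelfAdjoint),
      hM.spectrum_real_eq_range_eigenvalues]
    rintro _ ⟨i, rfl⟩
    exact ciInf_le (Set.finite_range _).bddBelow i
  have h := (Matrix.le_iff.mp hle).dotProduct_mulVec_nonneg x
  simpa [Algebra.algebraMap_eq_smul_one, sub_mulVec, smul_mulVec, dotProduct_sub] using h

/-- If `A d = -p` with `A` positive semidefinite and `pᵀ A p ≤ c ‖p‖²`, then
`‖p‖² / c ≤ -dᵀ p`. -/
theorem dotProduct_self_div_le {n : ℕ} {A : Matrix (Fin n) (Fin n) ℝ} (hA : A.PosSemidef)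
    {d p : Fin n → ℝ} (hd : A *ᵥ d = -p) {c : ℝ} (hc : 0 < c)
    (hp : p ⬝ᵥ (A *ᵥ p) ≤ c * (p ⬝ᵥ p)) : p ⬝ᵥ p / c ≤ -(d ⬝ᵥ p) := by
  have hsymm : d ⬝ᵥ (A *ᵥ p) = -(p ⬝ᵥ p) := by
    have hT : Aᵀ = A := hA.isHermitian
    rw [dotProduct_mulVec, ← mulVec_transpose, hT, hd, neg_dotProduct]
  have h := hA.dotProduct_mulVec_nonneg (c • d + p)
  simp only [star_trivial, mulVec_add, mulVec_smul, dotProduct_add, add_dotProduct,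
    smul_dotProduct, dotProduct_smul, hd, hsymm, dotProduct_neg, smul_eq_mul] at h
  rw [div_le_iff₀ hc]
  refine le_of_mul_le_mul_left ?_ hc
  linarith

/-- eigenvalue-based lower bound on the predicted reduction. -/
theorem predicted_reduction_eigenvalue_bound {n : ℕ} (hn : 0 < n)
    (B : Matrix (Fin n) (Fin n) ℝ) (hBsymm : B.IsSymm)
    (P : Matrix (Fin n) (Fin n) ℝ) (hPsymm : P.IsSymm) (hPidem : P * P = P)
    (g : Fin n → ℝ) (p : Fin n → ℝ) (hp : p = P *ᵥ g)
    (τ : ℝ) (hτ : 0 < τ)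
    (hpd1 : (τ • (1 : Matrix (Fin n) (Fin n) ℝ) + B).PosDef)
    (hpd2 : (τ • (1 : Matrix (Fin n) (Fin n) ℝ) + B - Pᵀ * B * P).PosDef)
    (d : Fin n → ℝ) (hd : (τ • (1 : Matrix (Fin n) (Fin n) ℝ) + B) *ᵥ d = -p)
    (x₀ : Fin n → ℝ) (f₀ : ℝ)
    (q : (Fin n → ℝ) → ℝ)
    (hq : ∀ x, q x = f₀ + (x - x₀) ⬝ᵥ g + (1 / 2) * ((x - x₀) ⬝ᵥ (B *ᵥ (x - x₀))))
    (hM : (B - Pᵀ * B * P).IsHermitian)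
    (τlb : ℝ) (hτlb : τlb = min 0 (⨅ i, hM.eigenvalues i)) :
    q x₀ - q (x₀ + P *ᵥ d) ≥
      (1 / 2) * ((vecNorm p) ^ 2 / (τ + matNorm B) + (τ + τlb) * (vecNorm d) ^ 2) := by
  have hBn : 0 ≤ matNorm B := norm_nonneg _
  have hquad (x : Fin n → ℝ) : x ⬝ᵥ ((τ • (1 : Matrix (Fin n) (Fin n) ℝ) + B) *ᵥ x)
      = τ * (x ⬝ᵥ x) + x ⬝ᵥ (B *ᵥ x) := by
    simp [add_mulVec, smul_mulVec]
  have hPT : Pᵀ = P := hPsymm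
  have hPd (y : Fin n → ℝ) : (P *ᵥ d) ⬝ᵥ y = d ⬝ᵥ (P *ᵥ y) := by
    rw [dotProduct_mulVec, ← mulVec_transpose, hPT]
  have hgrad : p ⬝ᵥ p / (τ + matNorm B) ≤ -(d ⬝ᵥ p) := by
    refine dotProduct_self_div_le hpd1.posSemidef hd (by linarith) ?_
    have := dotProduct_mulVec_le_matNorm B p
    rw [vecNorm_sq] at this
    rw [hquad]
    linarith
  have hdd : τ * (d ⬝ᵥ d) + d ⬝ᵥ (B *ᵥ d) = -(d ⬝ᵥ p) := by
    rw [← hquad, hd, dotProduct_neg]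
  have hcurv : τlb * (d ⬝ᵥ d) ≤ d ⬝ᵥ (B *ᵥ d) - d ⬝ᵥ (P *ᵥ (B *ᵥ (P *ᵥ d))) := by
    calc τlb * (d ⬝ᵥ d) ≤ (⨅ i, hM.eigenvalues i) * (d ⬝ᵥ d) := by
          gcongr
          · exact vecNorm_sq d ▸ sq_nonneg _
          · exact hτlb ▸ min_le_right _ _
      _ ≤ d ⬝ᵥ ((B - Pᵀ * B * P) *ᵥ d) := iInf_eigenvalues_mul_le hM d
      _ = _ := by simp [sub_mulVec, dotProduct_sub, hPT, ← mulVec_mulVec]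
  rw [hq, hq, vecNorm_sq, vecNorm_sq]
  simp only [sub_self, zero_dotProduct, add_sub_cancel_left, hPd, ← hp]
  linarith
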